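/- arXiv:2007.02335 — 2 statements merged into one kernel-verified Lean document; each statement's English description precedes it below -/
import Mathlib

section
/- Every Schwartz function g on ℝⁿ belongs to the local Orlicz–Campanato space L_loc^{Φ_p}(ℝⁿ) for every p ∈ (0,1), and the embedding S(ℝⁿ) ↪ L_loc^{Φ_p}(ℝⁿ) is continuous; more precisely, with s = ⌊n(1/p−1)⌋, ‖g‖_{L_loc^{Φ_p}} ≲ Σ_{|β|=s+1} sup_{y∈ℝⁿ} |∂^β g(y)| + sup_{y∈ℝⁿ} |g(y)|. -/
open MeasureTheory

/-- The Orlicz function `Φ_p(τ) = τ / (1 + τ^(1-p))`. -/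
noncomputable def PhiP (p τ : ℝ) : ℝ := τ / (1 + τ ^ (1 - p))

/-- The Luxemburg quasi-norm with respect to `Φ_p` on `ℝⁿ`. -/
noncomputable def luxNorm (n : ℕ) (p : ℝ) (f : EuclideanSpace ℝ (Fin n) → ℝ) : ℝ :=
  sInf {lam : ℝ | 0 < lam ∧ ∫ x, PhiP p (|f x| / lam) ≤ 1}

/-- Evaluation of a real polynomial in `n` variables at a point of `ℝⁿ`. -/
noncomputable def mvEval {n : ℕ} (x : EuclideanSpace ℝ (Fin n))
    (P : MvPolynomial (Fin n) ℝ) : ℝ :=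
  MvPolynomial.eval (fun i => x i) P

open Set Metric

section Taylor

variable {E : Type*} [NormedAddCommGroup E] [NormedSpace ℝ E]

/-- The iterated derivatives of a function along a line are its iterated Fréchet derivatives
evaluated at the direction of the line. -/
lemma iteratedDeriv_comp_smul_add {g : E → ℝ} {k : ℕ} (hg : ContDiff ℝ k g) (x v : E) (t : ℝ) :
    iteratedDeriv k (fun t : ℝ => g (t • v + x)) t =
      iteratedFDeriv ℝ k g (t • v + x) fun _ => v := by
  have hcomp : (fun t : ℝ => g (t • v + x)) =
      (fun z => g (z + x)) ∘ ContinuousLinearMap.toSpanSingleton ℝ v := by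
    ext t
    simp
  have hg' : ContDiff ℝ k fun z => g (z + x) := hg.comp (contDiff_id.add contDiff_const)
  rw [iteratedDeriv_eq_iteratedFDeriv, hcomp,
    ContinuousLinearMap.iteratedFDeriv_comp_right _ hg' t le_rfl]
  simp [iteratedFDeriv_comp_add_right]

/-- Taylor's theorem in several variables, with a bound on the remainder. -/
lemma abs_sub_taylor_le {g : E → ℝ} {m : ℕ} (hg : ContDiff ℝ (m + 1) g) {K : ℝ}
    (hK : ∀ x, ‖iteratedFDeriv ℝ (m + 1) g x‖ ≤ K) (x y : E) :
    |g y - ∑ k ∈ Finset.range (m + 1),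
      (k.factorial : ℝ)⁻¹ * iteratedFDeriv ℝ k g x fun _ => y - x| ≤ K * ‖y - x‖ ^ (m + 1) := by
  have hK0 : 0 ≤ K := (norm_nonneg _).trans (hK x)
  set φ : ℝ → ℝ := fun t => g (t • (y - x) + x) with hφ
  have hφc : ContDiff ℝ (m + 1) φ :=
    hg.comp ((contDiff_id.smul contDiff_const).add contDiff_const)
  obtain ⟨t, -, ht⟩ := taylor_mean_remainder_lagrange_iteratedDeriv (n := m) (zero_ne_one' ℝ)
    hφc.contDiffOn
  have hsum : taylorWithinEval φ m (uIcc 0 1) 0 1 = ∑ k ∈ Finset.range (m + 1),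
      (k.factorial : ℝ)⁻¹ * iteratedFDeriv ℝ k g x fun _ => y - x := by
    rw [taylor_within_apply]
    refine Finset.sum_congr rfl fun k hk => ?_
    have hkm : (k : WithTop ℕ∞) ≤ m + 1 := by
      exact_mod_cast (Finset.mem_range.1 hk).le
    rw [iteratedDerivWithin_eq_iteratedDeriv (uniqueDiffOn_uIcc zero_ne_one)
      (hφc.of_le hkm).contDiffAt left_mem_uIcc, hφ, iteratedDeriv_comp_smul_add (hg.of_le hkm)]
    simp
  have hφ1 : φ 1 = g y := by simp [hφ]
  rw [hsum, hφ1, hφ, iteratedDeriv_comp_smul_add (by exact_mod_cast hg)] at ht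
  rw [ht, sub_zero, one_pow, mul_one, abs_div, Nat.abs_cast]
  refine (div_le_self (abs_nonneg _) (by exact_mod_cast (m + 1).factorial_pos)).trans ?_
  rw [← Real.norm_eq_abs]
  refine ((iteratedFDeriv ℝ (m + 1) g _).le_opNorm _).trans ?_
  rw [Finset.prod_const, Finset.card_univ, Fintype.card_fin]
  gcongr
  exact hK _

end Taylor

section Polynomial

variable {n : ℕ}

@[fun_prop]
lemma continuous_mvEval (P : MvPolynomial (Fin n) ℝ) :
    Continuous fun x : EuclideanSpace ℝ (Fin n) => mvEval x P := by
  unfold mvEval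
  exact (MvPolynomial.continuous_eval P).comp (by fun_prop)

/-- A multilinear form evaluated on the diagonal is a polynomial of degree at most its arity. -/
lemma exists_mvEval_eq_multilinear {k : ℕ}
    (M : ContinuousMultilinearMap ℝ (fun _ : Fin k => EuclideanSpace ℝ (Fin n)) ℝ)
    (x : EuclideanSpace ℝ (Fin n)) :
    ∃ Q : MvPolynomial (Fin n) ℝ, Q.totalDegree ≤ k ∧
      ∀ y, mvEval y Q = M fun _ => y - x := by
  classical
  refine ⟨∑ f : Fin k → Fin n, MvPolynomial.C (M fun j => EuclideanSpace.single (f j) 1) *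
    ∏ j, (MvPolynomial.X (f j) - MvPolynomial.C (x (f j))), ?_, fun y => ?_⟩
  · refine MvPolynomial.totalDegree_finsetSum_le fun f _ => ?_
    refine (MvPolynomial.totalDegree_mul _ _).trans ?_
    rw [MvPolynomial.totalDegree_C, zero_add]
    refine (MvPolynomial.totalDegree_finsetProd _ _).trans ?_
    refine (Finset.sum_le_card_nsmul _ _ 1 fun j _ => ?_).trans (by simp)
    exact (MvPolynomial.totalDegree_sub_C_le _ _).trans (MvPolynomial.totalDegree_X _).le
  · have hexp : y - x = ∑ i, (y i - x i) • EuclideanSpace.single i (1 : ℝ) := by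
      ext j
      simp [Finset.sum_apply, Pi.single_apply]
    conv_rhs => rw [hexp]
    rw [M.map_sum]
    simp_rw [M.map_smul_univ]
    simp [mvEval, mul_comm]

/-- A smooth function is approximated near a point by a polynomial of degree at most `m`, with the
Taylor bound on the error. -/
lemma exists_mvEval_approx {g : EuclideanSpace ℝ (Fin n) → ℝ} {m : ℕ}
    (hg : ContDiff ℝ (m + 1) g) {K : ℝ} (hK : ∀ x, ‖iteratedFDeriv ℝ (m + 1) g x‖ ≤ K)
    (x : EuclideanSpace ℝ (Fin n)) :
    ∃ T : MvPolynomial (Fin n) ℝ, T.totalDegree ≤ m ∧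
      ∀ y, |g y - mvEval y T| ≤ K * ‖y - x‖ ^ (m + 1) := by
  choose Q hQd hQ using fun k => exists_mvEval_eq_multilinear (iteratedFDeriv ℝ k g x) x
  refine ⟨∑ k ∈ Finset.range (m + 1), MvPolynomial.C (k.factorial : ℝ)⁻¹ * Q k, ?_, fun y => ?_⟩
  · refine MvPolynomial.totalDegree_finsetSum_le fun k hk => ?_
    refine (MvPolynomial.totalDegree_mul _ _).trans ?_
    rw [MvPolynomial.totalDegree_C, zero_add]
    exact (hQd k).trans (Nat.lt_succ_iff.1 (Finset.mem_range.1 hk))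
  · convert abs_sub_taylor_le hg hK x y using 3
    simp only [← hQ, mvEval, map_sum, map_mul, MvPolynomial.eval_C]

end Polynomial

section Integral

/-- A continuous function is integrable on balls of a proper space. -/
lemma Continuous.integrableOn_ball {X : Type*} [MetricSpace X] [ProperSpace X]
    [MeasurableSpace X] [OpensMeasurableSpace X] {μ : Measure X} [IsFiniteMeasureOnCompacts μ]
    {f : X → ℝ} (hf : Continuous f) (x : X) (r : ℝ) : IntegrableOn f (ball x r) μ :=
  (hf.continuousOn.integrableOn_compact (isCompact_closedBall x r)).mono_set ball_subset_closedBall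

/-- If `∫ h² ≤ ∫ h e` with `|e| ≤ M`, then the `L¹` norm of `h` is at most `M` times the total
mass. -/
lemma integral_abs_le_of_integral_sq_le {X : Type*} [MeasurableSpace X] {μ : Measure X}
    [IsFiniteMeasure μ] {h e : X → ℝ} (hh : Integrable h μ) (hsq : Integrable (fun x => h x ^ 2) μ)
    (hhe : Integrable (fun x => h x * e x) μ) {M : ℝ} (he : ∀ᵐ x ∂μ, |e x| ≤ M)
    (horth : ∫ x, h x ^ 2 ∂μ ≤ ∫ x, h x * e x ∂μ) :
    ∫ x, |h x| ∂μ ≤ M * μ.real univ := by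
  rcases eq_or_ne μ 0 with rfl | hμ
  · simp
  have : NeZero μ := ⟨hμ⟩
  have hM : 0 ≤ M := by
    obtain ⟨x, hx⟩ := he.exists
    exact (abs_nonneg _).trans hx
  have key : ∀ N > M, ∫ x, |h x| ∂μ ≤ N * μ.real univ := by
    intro N hN
    have hN0 : 0 < N := hM.trans_lt hN
    have h1 : ∫ x, h x * e x ∂μ ≤ N * ∫ x, |h x| ∂μ := by
      rw [← integral_const_mul]
      refine integral_mono_ae hhe (hh.abs.const_mul N) ?_
      filter_upwards [he] with x hx
      calc h x * e x ≤ |h x| * |e x| := by rw [← abs_mul]; exact le_abs_self _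
        _ ≤ |h x| * N := by gcongr; exact hx.trans hN.le
        _ = N * |h x| := mul_comm _ _
    have h2 : 2 * N * ∫ x, |h x| ∂μ ≤ (∫ x, h x ^ 2 ∂μ) + N ^ 2 * μ.real univ := by
      have hc : ∫ _, N ^ 2 ∂μ = N ^ 2 * μ.real univ := by simp [mul_comm]
      rw [← hc, ← integral_const_mul, ← integral_add hsq (integrable_const _)]
      refine integral_mono (hh.abs.const_mul _) (hsq.add (integrable_const _)) fun x => ?_
      have := sq_nonneg (|h x| - N)
      rw [sub_sq, sq_abs] at this
      dsimp only [Pi.add_apply]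
      linarith
    refine le_of_mul_le_mul_left ?_ hN0
    nlinarith
  have hcont : Filter.Tendsto (fun N => N * μ.real univ) (nhdsWithin M (Ioi M))
      (nhds (M * μ.real univ)) :=
    ((continuous_id.mul continuous_const).tendsto M).mono_left nhdsWithin_le_nhds
  exact ge_of_tendsto hcont (Filter.eventually_of_mem self_mem_nhdsWithin key)

end Integral

section Luxemburg

/-- A lower bound for the parameters admissible in the Luxemburg quasi-norm of an indicator. -/
lemma min_le_of_mul_PhiP_le_one {p V lam : ℝ} (hp : p ∈ Ioo (0 : ℝ) 1) (hV : 0 < V)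
    (hlam : 0 < lam) (h : V * PhiP p (1 / lam) ≤ 1) :
    min V (V ^ (1 / p)) ≤ 2 ^ (1 / p) * lam := by
  obtain ⟨hp0, hp1⟩ := hp
  have hτ : 0 < 1 / lam := by positivity
  have hpow : 0 < (1 / lam) ^ (1 - p) := Real.rpow_pos_of_pos hτ _
  rw [PhiP, ← mul_div_assoc, div_le_one (by positivity)] at h
  rcases le_total 1 lam with hl | hl
  · refine (min_le_left _ _).trans ?_
    have h1 : (1 / lam) ^ (1 - p) ≤ 1 :=
      Real.rpow_le_one hτ.le ((div_le_one hlam).2 hl) (by linarith)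
    have h2 : V ≤ 2 * lam := by
      rw [mul_one_div] at h
      exact (div_le_iff₀ hlam).1 (h.trans (by linarith))
    have h3 : (2 : ℝ) ≤ 2 ^ (1 / p) :=
      Real.self_le_rpow_of_one_le one_le_two ((one_le_div hp0).2 hp1.le)
    exact h2.trans (by gcongr)
  · refine (min_le_right _ _).trans ?_
    have h1 : 1 ≤ (1 / lam) ^ (1 - p) :=
      Real.one_le_rpow ((one_le_div hlam).2 hl) (by linarith)
    have h2 : V * (1 / lam) ≤ 2 * (1 / lam) ^ (1 - p) := h.trans (by linarith)
    have h3 : (1 / lam) ^ (1 - p) = lam ^ p * (1 / lam) := by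
      rw [Real.rpow_sub hτ, Real.rpow_one, one_div, Real.inv_rpow hlam.le]
      field_simp
    rw [h3, ← mul_assoc] at h2
    calc V ^ (1 / p) ≤ (2 * lam ^ p) ^ (1 / p) := by
          gcongr
          exact le_of_mul_le_mul_right h2 hτ
      _ = 2 ^ (1 / p) * lam := by
          rw [Real.mul_rpow zero_le_two (by positivity), ← Real.rpow_mul hlam.le,
            mul_one_div_cancel hp0.ne', Real.rpow_one]

/-- The Luxemburg quasi-norm of an indicator dominates `min {|B|, |B|^(1/p)}`. -/
lemma min_volume_le_luxNorm_indicator {n : ℕ} {p : ℝ} (hp : p ∈ Ioo (0 : ℝ) 1)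
    {B : Set (EuclideanSpace ℝ (Fin n))} (hB : MeasurableSet B) (hB0 : 0 < volume.real B) :
    min (volume.real B) (volume.real B ^ (1 / p)) ≤
      2 ^ (1 / p) * luxNorm n p (B.indicator fun _ => (1 : ℝ)) := by
  have hint : ∀ lam : ℝ, ∫ x, PhiP p (|B.indicator (fun _ => (1 : ℝ)) x| / lam) =
      volume.real B * PhiP p (1 / lam) := by
    intro lam
    have : (fun x => PhiP p (|B.indicator (fun _ => (1 : ℝ)) x| / lam)) =
        B.indicator fun _ => PhiP p (1 / lam) := by
      ext x
      by_cases hx : x ∈ B <;> simp [hx, PhiP]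
    rw [this, integral_indicator_const _ hB, smul_eq_mul]
  have h2 : (0 : ℝ) < 2 ^ (1 / p) := by positivity
  rw [mul_comm, ← div_le_iff₀ h2, luxNorm]
  simp only [hint]
  refine le_csInf ⟨volume.real B, hB0, ?_⟩ fun lam hlam => ?_
  · have hτ : 0 < 1 / volume.real B := by positivity
    have hle : PhiP p (1 / volume.real B) ≤ 1 / volume.real B :=
      div_le_self hτ.le (by linarith [Real.rpow_pos_of_pos hτ (1 - p)])
    calc volume.real B * PhiP p (1 / volume.real B)
        ≤ volume.real B * (1 / volume.real B) := by gcongr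
      _ = 1 := mul_one_div_cancel hB0.ne'
  · rw [div_le_iff₀ h2, mul_comm]
    exact min_le_of_mul_PhiP_le_one hp hB0 hlam.1 hlam.2

end Luxemburg

section Campanato

variable {n : ℕ}

lemma volume_real_ball_pos (x : EuclideanSpace ℝ (Fin n)) {r : ℝ} (hr : 0 < r) :
    0 < volume.real (ball x r) :=
  ENNReal.toReal_pos (measure_ball_pos volume x hr).ne' measure_ball_lt_top.ne

/-- The mean oscillation of a smooth function against its minimizing polynomial of degree at most
`m` on a ball is controlled by the derivatives of order `m + 1`. -/
lemma integral_abs_sub_minimizing_le {g : EuclideanSpace ℝ (Fin n) → ℝ} {m : ℕ}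
    (hg : ContDiff ℝ (m + 1) g) {K : ℝ} (hK : ∀ x, ‖iteratedFDeriv ℝ (m + 1) g x‖ ≤ K)
    (x₀ : EuclideanSpace ℝ (Fin n)) (r : ℝ) {P : MvPolynomial (Fin n) ℝ} (hP : P.totalDegree ≤ m)
    (horth : ∀ R : MvPolynomial (Fin n) ℝ, R.totalDegree ≤ m →
      ∫ x in ball x₀ r, (g x - mvEval x P) * mvEval x R = 0) :
    ∫ x in ball x₀ r, |g x - mvEval x P| ≤ K * r ^ (m + 1) * volume.real (ball x₀ r) := by
  have hK0 : 0 ≤ K := (norm_nonneg _).trans (hK x₀)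
  obtain ⟨T, hTd, hT⟩ := exists_mvEval_approx hg hK x₀
  have hgc : Continuous g := hg.continuous
  have : IsFiniteMeasure (volume.restrict (ball x₀ r)) := ⟨by simp [measure_ball_lt_top]⟩
  rw [← measureReal_restrict_apply_univ]
  refine integral_abs_le_of_integral_sq_le (e := fun x => g x - mvEval x T)
    (Continuous.integrableOn_ball (by fun_prop) x₀ r)
    (Continuous.integrableOn_ball (by fun_prop) x₀ r)
    (Continuous.integrableOn_ball (by fun_prop) x₀ r) ?_ (le_of_eq ?_)
  · refine ae_restrict_of_forall_mem measurableSet_ball fun x hx => (hT x).trans ?_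
    gcongr
    exact (mem_ball_iff_norm.1 hx).le
  · rw [← sub_eq_zero, ← integral_sub (Continuous.integrableOn_ball (by fun_prop) x₀ r)
      (Continuous.integrableOn_ball (by fun_prop) x₀ r),
      ← horth (T - P) ((MvPolynomial.totalDegree_sub _ _).trans (max_le hTd hP))]
    congr 1 with x
    simp only [mvEval, map_sub]
    ring

/-- A power of the radius of a ball as a power of its volume. -/
lemma pow_eq_volume_ball_rpow (hn : 0 < n) (x₀ : EuclideanSpace ℝ (Fin n)) {r : ℝ} (hr : 0 < r)
    (k : ℕ) :
    r ^ k = volume.real (ball (0 : EuclideanSpace ℝ (Fin n)) 1) ^ (-(k / n : ℝ)) *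
      volume.real (ball x₀ r) ^ (k / n : ℝ) := by
  have : Nonempty (Fin n) := ⟨⟨0, hn⟩⟩
  have hn' : (n : ℝ) ≠ 0 := by positivity
  have hc : 0 < volume.real (ball (0 : EuclideanSpace ℝ (Fin n)) 1) :=
    volume_real_ball_pos 0 one_pos
  have hV : volume.real (ball x₀ r) =
      r ^ n * volume.real (ball (0 : EuclideanSpace ℝ (Fin n)) 1) := by
    rw [measureReal_def, Measure.addHaar_ball _ _ hr.le, ENNReal.toReal_mul,
      ENNReal.toReal_ofReal (by positivity), finrank_euclideanSpace_fin, measureReal_def]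
  rw [hV, Real.mul_rpow (by positivity) hc.le, mul_left_comm, ← Real.rpow_add hc, neg_add_cancel,
    Real.rpow_zero, mul_one, ← Real.rpow_natCast r n, ← Real.rpow_mul hr.le, mul_div_cancel₀ _ hn',
    Real.rpow_natCast]

end Campanato

/-- Every Schwartz function `g` on `ℝⁿ` belongs to the local Orlicz–Campanato space
`L_loc^{Φ_p}(ℝⁿ)` for every `p ∈ (0,1)`, continuously: with `s = ⌊n(1/p−1)⌋`, both components
of `‖g‖_{L_loc^{Φ_p}}` (oscillations against the minimizing polynomial of degree ≤ s on balls
of measure < 1, and plain averages on balls of measure ≥ 1, normalized by the Luxemburg norm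
of the ball's indicator) are bounded by
`C(∑_{|β| = s+1} sup |∂^β g| + sup |g|)`, here encoded via `sup ‖D^{s+1} g‖ + sup |g|`. -/
theorem stmt_9 (n : ℕ) (hn : 0 < n) (p : ℝ) (hp : p ∈ Set.Ioo (0 : ℝ) 1) :
    ∃ C > (0 : ℝ), ∀ g : SchwartzMap (EuclideanSpace ℝ (Fin n)) ℝ,
      (∀ (x₀ : EuclideanSpace ℝ (Fin n)) (r : ℝ), 0 < r →
        (volume (Metric.ball x₀ r)).toReal < 1 →
        ∀ P : MvPolynomial (Fin n) ℝ,
          P.totalDegree ≤ ⌊(n : ℝ) * (1 / p - 1)⌋₊ →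
          (∀ R : MvPolynomial (Fin n) ℝ, R.totalDegree ≤ ⌊(n : ℝ) * (1 / p - 1)⌋₊ →
            ∫ x in Metric.ball x₀ r, (g x - mvEval x P) * mvEval x R = 0) →
          ∫ x in Metric.ball x₀ r, |g x - mvEval x P| ≤
            C * luxNorm n p ((Metric.ball x₀ r).indicator fun _ => (1 : ℝ)) *
              ((⨆ x, ‖iteratedFDeriv ℝ (⌊(n : ℝ) * (1 / p - 1)⌋₊ + 1) g x‖) +
                ⨆ x, |g x|)) ∧
      (∀ (x₀ : EuclideanSpace ℝ (Fin n)) (r : ℝ), 0 < r →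
        1 ≤ (volume (Metric.ball x₀ r)).toReal →
        ∫ x in Metric.ball x₀ r, |g x| ≤
          C * luxNorm n p ((Metric.ball x₀ r).indicator fun _ => (1 : ℝ)) *
            ((⨆ x, ‖iteratedFDeriv ℝ (⌊(n : ℝ) * (1 / p - 1)⌋₊ + 1) g x‖) +
              ⨆ x, |g x|)) := by
  obtain ⟨hp0, hp1⟩ := id hp
  set s := ⌊(n : ℝ) * (1 / p - 1)⌋₊
  have hn' : (0 : ℝ) < n := by exact_mod_cast hn
  set c := volume.real (ball (0 : EuclideanSpace ℝ (Fin n)) 1) ^ (-((s + 1 : ℕ) / n : ℝ))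
  have hc0 : 0 ≤ c := Real.rpow_nonneg measureReal_nonneg _
  have h2 : (0 : ℝ) < 2 ^ (1 / p) := by positivity
  refine ⟨2 ^ (1 / p) * (c + 1), by positivity, fun g => ?_⟩
  set K := ⨆ x, ‖iteratedFDeriv ℝ (s + 1) g x‖
  set G := ⨆ x, |g x|
  have hK : ∀ x, ‖iteratedFDeriv ℝ (s + 1) g x‖ ≤ K := le_ciSup
    ⟨_, forall_mem_range.2 (g.norm_iteratedFDeriv_le_seminorm ℝ (s + 1))⟩
  have hG : ∀ x, |g x| ≤ G := le_ciSup ⟨_, forall_mem_range.2 (g.norm_le_seminorm ℝ)⟩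
  have hK0 : 0 ≤ K := (norm_nonneg _).trans (hK 0)
  have hG0 : 0 ≤ G := (abs_nonneg _).trans (hG 0)
  have hlux : ∀ (x₀ : EuclideanSpace ℝ (Fin n)) (r : ℝ), 0 < r →
      min (volume.real (ball x₀ r)) (volume.real (ball x₀ r) ^ (1 / p)) ≤
        2 ^ (1 / p) * luxNorm n p ((ball x₀ r).indicator fun _ => (1 : ℝ)) := fun x₀ r hr =>
    min_volume_le_luxNorm_indicator hp measurableSet_ball (volume_real_ball_pos x₀ hr)
  refine ⟨fun x₀ r hr hV P hP horth => ?_, fun x₀ r hr hV => ?_⟩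
  · rw [← measureReal_def] at hV
    have hL := hlux x₀ r hr
    set L := luxNorm n p ((ball x₀ r).indicator fun _ => (1 : ℝ))
    set V := volume.real (ball x₀ r)
    have hV0 : 0 < V := volume_real_ball_pos x₀ hr
    have hexp : 1 / p ≤ ((s + 1 : ℕ) / n : ℝ) + 1 := by
      rw [← sub_le_iff_le_add, le_div_iff₀ hn', mul_comm]
      push_cast
      exact (Nat.lt_floor_add_one _).le
    have hmin : V ^ (1 / p) ≤ 2 ^ (1 / p) * L := by
      refine (le_min ?_ le_rfl).trans hL
      exact Real.rpow_le_self_of_le_one hV0.le hV.le ((one_le_div hp0).2 hp1.le)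
    calc ∫ x in ball x₀ r, |g x - mvEval x P| ≤ K * r ^ (s + 1) * V :=
          integral_abs_sub_minimizing_le (g.smooth _) hK x₀ r hP horth
      _ = K * c * V ^ (((s + 1 : ℕ) / n : ℝ) + 1) := by
          rw [pow_eq_volume_ball_rpow hn x₀ hr, Real.rpow_add_one hV0.ne']
          ring
      _ ≤ K * c * V ^ (1 / p) := by
          gcongr K * c * ?_
          exact Real.rpow_le_rpow_of_exponent_ge hV0 hV.le hexp
      _ ≤ (K + G) * (c + 1) * (2 ^ (1 / p) * L) := by
          gcongr <;> linarith
      _ = 2 ^ (1 / p) * (c + 1) * L * (K + G) := by ring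
  · rw [← measureReal_def] at hV
    have hL := hlux x₀ r hr
    set L := luxNorm n p ((ball x₀ r).indicator fun _ => (1 : ℝ))
    set V := volume.real (ball x₀ r)
    have hmin : V ≤ 2 ^ (1 / p) * L := by
      refine (le_min le_rfl ?_).trans hL
      exact Real.self_le_rpow_of_one_le hV ((one_le_div hp0).2 hp1.le)
    have hint : ∫ x in ball x₀ r, |g x| ≤ ∫ _ in ball x₀ r, G :=
      integral_mono (Continuous.integrableOn_ball (by fun_prop) x₀ r)
        (Continuous.integrableOn_ball continuous_const x₀ r) hG
    calc ∫ x in ball x₀ r, |g x| ≤ G * 1 * V := by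
          rw [setIntegral_const, smul_eq_mul] at hint
          linarith
      _ ≤ (K + G) * (c + 1) * (2 ^ (1 / p) * L) := by
          gcongr <;> linarith
      _ = 2 ^ (1 / p) * (c + 1) * L * (K + G) := by ring
end

section
/- Let α ∈ (0,∞). Every Schwartz function g on ℝⁿ is a pointwise multiplier of the inhomogeneous Lipschitz space Λ_{nα}(ℝⁿ): there is a constant C(g) such that ‖gf‖_{Λ_{nα}} ≤ C(g) ‖f‖_{Λ_{nα}} for all f ∈ Λ_{nα}(ℝⁿ). -/
open MeasureTheory

/-- Iterated difference operator: `D_h^k f`. -/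
def iterDiff {n : ℕ} (h : EuclideanSpace ℝ (Fin n)) (f : EuclideanSpace ℝ (Fin n) → ℝ) :
    ℕ → EuclideanSpace ℝ (Fin n) → ℝ
  | 0 => f
  | k + 1 => fun x => iterDiff h f k (x + h) - iterDiff h f k x

section IterDiff

variable {n : ℕ}

local notation "E" => EuclideanSpace ℝ (Fin n)

lemma iterDiff_succ_left (h : E) (f : E → ℝ) (k : ℕ) :
    iterDiff h f (k + 1) = iterDiff h (fun y => f (y + h) - f y) k := by
  induction k with
  | zero => rfl
  | succ k ih =>
    funext x
    change iterDiff h f (k + 1) (x + h) - iterDiff h f (k + 1) x = _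
    rw [ih]
    rfl

lemma iterDiff_add (h : E) (f g : E → ℝ) (k : ℕ) (x : E) :
    iterDiff h (fun y => f y + g y) k x = iterDiff h f k x + iterDiff h g k x := by
  induction k generalizing x with
  | zero => rfl
  | succ k ih => simp only [iterDiff, ih]; ring

lemma iterDiff_const_mul (h : E) (c : ℝ) (f : E → ℝ) (k : ℕ) (x : E) :
    iterDiff h (fun y => c * f y) k x = c * iterDiff h f k x := by
  induction k generalizing x with
  | zero => rfl
  | succ k ih => simp only [iterDiff, ih]; ring

lemma iterDiff_comp_add_right (h a : E) (f : E → ℝ) (k : ℕ) (x : E) :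
    iterDiff h (fun y => f (y + a)) k x = iterDiff h f k (x + a) := by
  induction k generalizing x with
  | zero => rfl
  | succ k ih => simp only [iterDiff, ih, add_right_comm]

lemma abs_iterDiff_le_of_bounded (h : E) (f : E → ℝ) {M : ℝ} (hf : ∀ x, |f x| ≤ M)
    (k : ℕ) (x : E) : |iterDiff h f k x| ≤ 2 ^ k * M := by
  induction k generalizing x with
  | zero => simpa [iterDiff] using hf x
  | succ k ih =>
    simp only [iterDiff]
    have h1 := abs_sub (iterDiff h f k (x + h)) (iterDiff h f k x)
    have h2 := ih (x + h)
    have h3 := ih x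
    rw [pow_succ]
    linarith

/-- A bound for iterated differences of a product, from bounds on all complementary pairs of
differences of the factors. -/
lemma abs_iterDiff_mul_le (h : E) (k : ℕ) (R : ℝ) (f g : E → ℝ) (p q : ℕ → ℝ)
    (hg : ∀ i x, |iterDiff h g i x| ≤ p i) (hf : ∀ i, i ≤ k → ∀ x, |iterDiff h f i x| ≤ q i)
    (hpq : ∀ i j, i + j = k → p i * q j ≤ R) (x : E) :
    |iterDiff h (fun y => g y * f y) k x| ≤ 2 ^ k * R := by
  induction k generalizing f g p q x with
  | zero =>
    simp only [iterDiff, pow_zero, one_mul, abs_mul]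
    refine le_trans ?_ (hpq 0 0 rfl)
    exact mul_le_mul (hg 0 x) (hf 0 le_rfl x) (abs_nonneg _) ((abs_nonneg _).trans (hg 0 x))
  | succ k ih =>
    have hsplit : (fun y => g (y + h) * f (y + h) - g y * f y) =
        fun y => g (y + h) * (f (y + h) - f y) + (g (y + h) - g y) * f y := by
      funext y; ring
    rw [iterDiff_succ_left, hsplit, iterDiff_add h
      (fun y => g (y + h) * (f (y + h) - f y)) (fun y => (g (y + h) - g y) * f y)]
    have h1 := ih (fun y => f (y + h) - f y) (fun y => g (y + h)) p (fun i => q (i + 1))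
      (fun i x => by rw [iterDiff_comp_add_right]; exact hg i _)
      (fun i hi x => by rw [← iterDiff_succ_left]; exact hf _ (by omega) x)
      (fun i j hij => hpq i (j + 1) (by omega)) x
    have h2 := ih f (fun y => g (y + h) - g y) (fun i => p (i + 1)) q
      (fun i x => by rw [← iterDiff_succ_left]; exact hg _ x)
      (fun i hi x => hf i (by omega) x)
      (fun i j hij => hpq (i + 1) j (by omega)) x
    refine (abs_add_le _ _).trans ?_
    rw [pow_succ]
    linarith

lemma sub_add_self_eq (h : E) (f : E → ℝ) (y : E) :
    f (y + (h + h)) - f y = (f (y + h + h) - f (y + h)) + (f (y + h) - f y) := by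
  rw [add_assoc]; ring

lemma abs_iterDiff_double_le (h : E) (j : ℕ) (f : E → ℝ) {B : ℝ}
    (hf : ∀ x, |iterDiff h f j x| ≤ B) (x : E) :
    |iterDiff (h + h) f j x| ≤ 2 ^ j * B := by
  induction j generalizing f x with
  | zero => simpa [iterDiff] using hf x
  | succ j ih =>
    simp only [iterDiff_succ_left] at hf ⊢
    have hd := ih _ hf
    simp only [sub_add_self_eq]
    rw [iterDiff_add (h + h) (fun y => f (y + h + h) - f (y + h)) (fun y => f (y + h) - f y),
      iterDiff_comp_add_right (h + h) h (fun y => f (y + h) - f y)]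
    refine (abs_add_le _ _).trans ?_
    have h1 := hd (x + h)
    have h2 := hd x
    rw [pow_succ]
    linarith

/-- Comparison of the differences with steps `2h` and `h`, the error being controlled by the
next difference. -/
lemma abs_iterDiff_double_sub_le (h : E) (j : ℕ) (f : E → ℝ) {B : ℝ}
    (hf : ∀ x, |iterDiff h f (j + 1) x| ≤ B) (x : E) :
    |iterDiff (h + h) f j x - 2 ^ j * iterDiff h f j x| ≤ j * 2 ^ j * B := by
  induction j generalizing f x with
  | zero => simp [iterDiff]
  | succ j ih =>
    have hB : 0 ≤ B := (abs_nonneg _).trans (hf x)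
    have h1 := ih (fun y => f (y + h) - f y)
      (fun x => by rw [← iterDiff_succ_left]; exact hf x) x
    have h2 := abs_iterDiff_double_le h j
      (fun y => (f (y + h + h) - f (y + h)) - (f (y + h) - f y)) (B := B)
      (fun x => by
        have := hf x
        rwa [iterDiff_succ_left, iterDiff_succ_left] at this) x
    have hsplit : (fun y => f (y + (h + h)) - f y) = fun y => 2 * (f (y + h) - f y) +
        ((f (y + h + h) - f (y + h)) - (f (y + h) - f y)) := by
      funext y; rw [add_assoc]; ring
    rw [iterDiff_succ_left (h + h), iterDiff_succ_left h, hsplit, iterDiff_add (h + h)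
      (fun y => 2 * (f (y + h) - f y))
      (fun y => (f (y + h + h) - f (y + h)) - (f (y + h) - f y)),
      iterDiff_const_mul (h + h) 2 (fun y => f (y + h) - f y)]
    have hP : 0 ≤ (2 : ℝ) ^ j * B := by positivity
    rw [abs_le] at h1 h2 ⊢
    push_cast
    rw [pow_succ]
    constructor <;> nlinarith [h1.1, h1.2, h2.1, h2.2]

/-- A Marchaud-type inequality: bounds on differences of order `j + 1` of a bounded function
yield bounds on differences of order `j`. -/
lemma abs_iterDiff_le_of_succ (j : ℕ) {τ σ : ℝ} (hτ : 0 ≤ τ) (hτσ : τ ≤ σ)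
    (f : E → ℝ) {M A K : ℝ} (hA : 0 ≤ A) (hf : ∀ x, |f x| ≤ M)
    (hsucc : ∀ x h : E, h ≠ 0 → |iterDiff h f (j + 1) x| ≤ A * ‖h‖ ^ σ)
    (hK : 2 ^ j * M ≤ K) (hK' : (2 : ℝ) ^ (τ - j) * K + j * A ≤ K)
    (x h : E) (hh : h ≠ 0) : |iterDiff h f j x| ≤ K * ‖h‖ ^ τ := by
  have hK0 : 0 ≤ K := by
    have : 0 ≤ M := (abs_nonneg _).trans (hf x)
    exact le_trans (by positivity) hK
  have large : ∀ (h x : E), 1 ≤ ‖h‖ → |iterDiff h f j x| ≤ K * ‖h‖ ^ τ := fun h x h1 =>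
    ((abs_iterDiff_le_of_bounded h f hf j x).trans hK).trans
      (le_mul_of_one_le_right hK0 (Real.one_le_rpow h1 hτ))
  have main : ∀ (N : ℕ) (h x : E), h ≠ 0 → 1 ≤ 2 ^ N * ‖h‖ →
      |iterDiff h f j x| ≤ K * ‖h‖ ^ τ := by
    intro N
    induction N with
    | zero => intro h x _ h1; exact large h x (by simpa using h1)
    | succ N ih =>
      intro h x h0 h1
      rcases le_total 1 ‖h‖ with hle | hle
      · exact large h x hle
      have hn : ‖h + h‖ = 2 * ‖h‖ := by
        rw [← two_smul ℝ h, norm_smul]; simp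
      have hpos : 0 < ‖h‖ := norm_pos_iff.2 h0
      have hdbl := ih (h + h) x (by rw [← norm_pos_iff, hn]; positivity)
        (by rw [hn]; rw [pow_succ] at h1; linarith)
      rw [hn, Real.mul_rpow (by norm_num) (norm_nonneg _)] at hdbl
      have hcmp := abs_iterDiff_double_sub_le h j f (fun x => hsucc x h h0) x
      have hpw : ‖h‖ ^ σ ≤ ‖h‖ ^ τ := Real.rpow_le_rpow_of_exponent_ge hpos hle hτσ
      have h2 : (2 : ℝ) ^ (τ - j) * 2 ^ j = 2 ^ τ := by
        rw [← Real.rpow_natCast, ← Real.rpow_add (by norm_num)]; simp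
      have h2j : (0 : ℝ) < 2 ^ j := by positivity
      have hX : 0 ≤ ‖h‖ ^ τ := by positivity
      have habs : 2 ^ j * |iterDiff h f j x| ≤
          |iterDiff (h + h) f j x| + j * 2 ^ j * (A * ‖h‖ ^ σ) := by
        rw [← abs_of_pos h2j, ← abs_mul, abs_of_pos h2j]
        rw [abs_sub_comm] at hcmp
        linarith [abs_sub_abs_le_abs_sub (2 ^ j * iterDiff h f j x) (iterDiff (h + h) f j x)]
      refine le_of_mul_le_mul_left ?_ h2j
      calc _ ≤ K * (2 ^ τ * ‖h‖ ^ τ) + j * 2 ^ j * (A * ‖h‖ ^ τ) := by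
            refine habs.trans (add_le_add hdbl ?_)
            gcongr
        _ = 2 ^ j * (((2 : ℝ) ^ (τ - j) * K + j * A) * ‖h‖ ^ τ) := by rw [← h2]; ring
        _ ≤ _ := by gcongr
  obtain ⟨N, hN⟩ := pow_unbounded_of_one_lt ‖h‖⁻¹ (one_lt_two : (1 : ℝ) < 2)
  refine main N h x hh ?_
  have hpos : 0 < ‖h‖ := norm_pos_iff.2 hh
  rw [← inv_mul_cancel₀ hpos.ne']
  gcongr

/-- Lower-order differences of a function in the Lipschitz space of order `s`. -/
lemma exists_abs_iterDiff_le {s : ℝ} (hs : 0 ≤ s) (k : ℕ) (hk : s < k) (i : ℕ) (hi : i < k) :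
    ∃ K : ℝ, 0 ≤ K ∧ ∀ (f : E → ℝ) (M L : ℝ), 0 ≤ M → 0 ≤ L → (∀ x, |f x| ≤ M) →
      (∀ x h : E, h ≠ 0 → |iterDiff h f k x| ≤ L * ‖h‖ ^ s) →
      ∀ x h : E, h ≠ 0 → |iterDiff h f (k - i) x| ≤ K * (M + L) * ‖h‖ ^ (max 0 (s - i)) := by
  induction i with
  | zero =>
    refine ⟨1, zero_le_one, fun f M L hM hL _ hd x h hh => (hd x h hh).trans ?_⟩
    simp only [Nat.cast_zero, sub_zero, max_eq_right hs, one_mul]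
    gcongr
    linarith
  | succ i ih =>
    obtain ⟨A, hA, H⟩ := ih (by omega)
    obtain ⟨j, rfl⟩ : ∃ j, k = j + (i + 1) := ⟨k - (i + 1), by omega⟩
    have hj : (0 : ℝ) < j := by exact_mod_cast (by omega : 0 < j)
    set τ : ℝ := max 0 (s - (i + 1 : ℕ)) with hτ
    have hτj : τ < j := by
      push_cast at hk
      rw [hτ, max_lt_iff]
      refine ⟨hj, ?_⟩
      push_cast
      linarith
    have hr : 0 < 1 - (2 : ℝ) ^ (τ - j) := by
      have := Real.rpow_lt_one_of_one_lt_of_neg (one_lt_two : (1 : ℝ) < 2) (sub_neg.2 hτj)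
      linarith
    refine ⟨2 ^ j + j * A / (1 - (2 : ℝ) ^ (τ - j)), by positivity,
      fun f M L hM hL hf hd x h hh => ?_⟩
    have e : j + (i + 1) - (i + 1) = j := by omega
    have e' : j + (i + 1) - i = j + 1 := by omega
    have H' := H f M L hM hL hf hd
    rw [e'] at H'
    rw [e]
    refine abs_iterDiff_le_of_succ j (le_max_left _ _) (σ := max 0 (s - i)) ?_ f
      (A := A * (M + L)) (by positivity) hf H' ?_ ?_ x h hh
    · refine max_le_max le_rfl ?_
      push_cast
      linarith
    · have h1 : 0 ≤ j * A / (1 - (2 : ℝ) ^ (τ - j)) := by positivity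
      have h2 : (0 : ℝ) < 2 ^ j := by positivity
      nlinarith [mul_nonneg h1 (add_nonneg hM hL), mul_nonneg h2.le hL]
    · have hc : j * A / (1 - (2 : ℝ) ^ (τ - j)) * (1 - (2 : ℝ) ^ (τ - j)) = j * A :=
        div_mul_cancel₀ _ hr.ne'
      have h2 : 0 ≤ (2 : ℝ) ^ j * (1 - (2 : ℝ) ^ (τ - j)) * (M + L) := by positivity
      linear_combination h2 - (M + L) * hc

lemma abs_iterDiff_le_of_iteratedFDeriv (i : ℕ) (F : E → ℝ) (hF : ContDiff ℝ (⊤ : ℕ∞) F)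
    {B : ℝ} (hB : ∀ x, ‖iteratedFDeriv ℝ i F x‖ ≤ B) (h x : E) :
    |iterDiff h F i x| ≤ B * ‖h‖ ^ i := by
  induction i generalizing F B x with
  | zero => simpa [iterDiff] using hB x
  | succ i ih =>
    have hsh : ContDiff ℝ (⊤ : ℕ∞) (fun y => F (y + h)) :=
      hF.comp (contDiff_id.add contDiff_const)
    rw [iterDiff_succ_left]
    refine (ih (fun y => F (y + h) - F y) (hsh.sub hF) (B := B * ‖h‖) (fun y => ?_) x).trans_eq
      (by ring)
    have e : iteratedFDeriv ℝ i (fun y => F (y + h) - F y) y =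
        iteratedFDeriv ℝ i F (y + h) - iteratedFDeriv ℝ i F y := by
      rw [← iteratedFDeriv_comp_add_right]
      exact iteratedFDeriv_sub_apply (hsh.of_le (by exact_mod_cast le_top)).contDiffAt
        (hF.of_le (by exact_mod_cast le_top)).contDiffAt
    rw [e]
    have hd : Differentiable ℝ (iteratedFDeriv ℝ i F) :=
      hF.differentiable_iteratedFDeriv (by exact_mod_cast ENat.natCast_lt_top i)
    have := Convex.norm_image_sub_le_of_norm_fderiv_le (𝕜 := ℝ) (f := iteratedFDeriv ℝ i F)
      (C := B) (s := Set.univ) (x := y) (y := y + h) (fun z _ => hd z)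
      (fun z _ => by rw [norm_fderiv_iteratedFDeriv]; exact hB z) convex_univ
      (Set.mem_univ _) (Set.mem_univ _)
    simpa using this

lemma SchwartzMap.exists_abs_iterDiff_le (g : SchwartzMap E ℝ) (i : ℕ) :
    ∃ G : ℝ, 0 ≤ G ∧ ∀ h x : E, |iterDiff h g i x| ≤ G * ‖h‖ ^ i :=
  ⟨SchwartzMap.seminorm ℝ 0 i g, apply_nonneg _ _, fun h x =>
    abs_iterDiff_le_of_iteratedFDeriv i g (g.smooth _)
      (fun y => g.norm_iteratedFDeriv_le_seminorm ℝ i y) h x⟩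

end IterDiff

/-- Let `α ∈ (0,∞)`. Every Schwartz function `g` on `ℝⁿ` is a pointwise multiplier of the
inhomogeneous Lipschitz space `Λ_{nα}(ℝⁿ)`: there is `C(g) > 0` such that for every
`f ∈ Λ_{nα}` (continuous, with `|f| ≤ M_f` and `|D_h^{⌊nα⌋+1} f(x)| ≤ L |h|^{nα}`, so that
`‖f‖_{Λ_{nα}} ≤ M_f + L`) the product `g·f` lies in `Λ_{nα}`, with bounds `M', L'` summing to
at most `C(g) (M_f + L)`, i.e. `‖gf‖_{Λ_{nα}} ≤ C(g) ‖f‖_{Λ_{nα}}`. -/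
theorem stmt_16 (n : ℕ) (hn : 0 < n) (α : ℝ) (hα : 0 < α)
    (g : SchwartzMap (EuclideanSpace ℝ (Fin n)) ℝ) :
    ∃ C > (0 : ℝ), ∀ (f : EuclideanSpace ℝ (Fin n) → ℝ) (Mf L : ℝ), 0 ≤ Mf → 0 ≤ L →
      Continuous f → (∀ x, |f x| ≤ Mf) →
      (∀ (x h : EuclideanSpace ℝ (Fin n)), h ≠ 0 →
        |iterDiff h f (⌊(n : ℝ) * α⌋₊ + 1) x| ≤ L * ‖h‖ ^ ((n : ℝ) * α)) →
      ∃ M' L' : ℝ, 0 ≤ M' ∧ 0 ≤ L' ∧ M' + L' ≤ C * (Mf + L) ∧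
        (∀ x, |g x * f x| ≤ M') ∧
        (∀ (x h : EuclideanSpace ℝ (Fin n)), h ≠ 0 →
          |iterDiff h (fun y => g y * f y) (⌊(n : ℝ) * α⌋₊ + 1) x| ≤
            L' * ‖h‖ ^ ((n : ℝ) * α)) := by
  set s : ℝ := (n : ℝ) * α with hs
  have hs0 : 0 < s := by positivity
  set k : ℕ := ⌊s⌋₊ + 1 with hk
  have hsk : s < k := by
    rw [hk]; push_cast; exact Nat.lt_floor_add_one s
  choose G hG0 hG using g.exists_abs_iterDiff_le
  have hq : ∀ j, ∃ K : ℝ, 0 ≤ K ∧ (j ≤ k → ∀ (f : EuclideanSpace ℝ (Fin n) → ℝ) (M L : ℝ),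
      0 ≤ M → 0 ≤ L → (∀ x, |f x| ≤ M) →
      (∀ x h : EuclideanSpace ℝ (Fin n), h ≠ 0 → |iterDiff h f k x| ≤ L * ‖h‖ ^ s) →
      ∀ x h : EuclideanSpace ℝ (Fin n), h ≠ 0 →
        |iterDiff h f j x| ≤ K * (M + L) * ‖h‖ ^ (max 0 (s - (k - j : ℕ)))) := by
    intro j
    rcases Nat.eq_zero_or_pos j with rfl | hj
    · refine ⟨1, zero_le_one, fun _ f M L hM hL hf _ x h _ => ?_⟩
      have : max 0 (s - (k - 0 : ℕ)) = 0 := max_eq_left (by simpa using hsk.le)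
      rw [this]
      simpa [iterDiff] using (hf x).trans (by linarith)
    · rcases le_or_gt j k with hjk | hjk
      · obtain ⟨K, hK, H⟩ := exists_abs_iterDiff_le (n := n) hs0.le k hsk (k - j) (by omega)
        rw [Nat.sub_sub_self hjk] at H
        exact ⟨K, hK, fun _ => H⟩
      · exact ⟨0, le_rfl, fun h => absurd h (by omega)⟩
  choose K hK0 hK using hq
  set R : ℝ := ∑ i ∈ Finset.range (k + 1), G i * K (k - i) with hR
  have hR0 : 0 ≤ R := Finset.sum_nonneg fun i _ => mul_nonneg (hG0 _) (hK0 _)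
  have hg0 : ∀ x, |g x| ≤ G 0 := fun x => by simpa [iterDiff] using hG 0 0 x
  refine ⟨G 0 + 2 ^ k * (G 0 + R) + 1, by have := hG0 0; positivity, ?_⟩
  intro f M L hM hL _ hf hd
  have hG00 := hG0 0
  have hgf : ∀ x, |g x * f x| ≤ G 0 * M := fun x => by
    rw [abs_mul]
    exact mul_le_mul (hg0 x) (hf x) (abs_nonneg _) hG00
  refine ⟨G 0 * M, 2 ^ k * (G 0 + R) * (M + L), by positivity, by positivity, ?_, hgf, ?_⟩
  · nlinarith [mul_nonneg hG00 hL]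
  intro x h hh
  have hpos : 0 < ‖h‖ := norm_pos_iff.2 hh
  rcases le_total 1 ‖h‖ with h1 | h1
  · refine (abs_iterDiff_le_of_bounded h _ hgf k x).trans ?_
    refine le_trans ?_ (le_mul_of_one_le_right (by positivity) (Real.one_le_rpow h1 hs0.le))
    rw [mul_assoc]
    gcongr <;> linarith
  · have hprod := abs_iterDiff_mul_le h k (R * (M + L) * ‖h‖ ^ s) f g (fun i => G i * ‖h‖ ^ i)
      (fun j => K j * (M + L) * ‖h‖ ^ (max 0 (s - (k - j : ℕ))))
      (fun i x => hG i h x) (fun j hj x => hK j hj f M L hM hL hf hd x h hh) ?_ x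
    · refine hprod.trans ?_
      rw [← mul_assoc, ← mul_assoc]
      gcongr
      linarith
    · intro i j hij
      have hkj : k - j = i := by omega
      have hki : k - i = j := by omega
      have hGK : G i * K j ≤ R := by
        rw [← hki]
        exact Finset.single_le_sum (f := fun i => G i * K (k - i))
          (fun i _ => mul_nonneg (hG0 _) (hK0 _)) (Finset.mem_range.2 (by omega))
      have hpw : ‖h‖ ^ i * ‖h‖ ^ (max 0 (s - i)) ≤ ‖h‖ ^ s := by
        rw [← Real.rpow_natCast, ← Real.rpow_add hpos]
        refine Real.rpow_le_rpow_of_exponent_ge hpos h1 ?_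
        linarith [le_max_right 0 (s - i)]
      rw [hkj]
      calc _ = G i * K j * (M + L) * (‖h‖ ^ i * ‖h‖ ^ (max 0 (s - i))) := by ring
        _ ≤ _ := by gcongr
end
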